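/- For all real x ≥ 0, log(Q(x)) lies between the two quadratics: −x²/2 − √(2/π)·x − log 2 ≤ log(Q(x)) ≤ −x²/π − √(2/π)·x − log 2, where Q is the Gaussian Q-function. -/

import Mathlib

open Real MeasureTheory

/-- The Gaussian Q-function: tail probability of a standard normal. -/
noncomputable def gaussQ (x : ℝ) : ℝ :=
  (1 / Real.sqrt (2 * Real.pi)) * ∫ u in Set.Ioi x, Real.exp (-u ^ 2 / 2)

/-- The standard normal density. -/
noncomputable def gaussPhi (x : ℝ) : ℝ :=
  Real.exp (-x ^ 2 / 2) / Real.sqrt (2 * Real.pi)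

theorem aux_nonneg (f w : ℝ → ℝ) (a b : ℝ) (hb : 0 < b) (hw : ∀ x, 0 ≤ x → 0 ≤ w x)
    (h0 : f 0 = 0) (hinf : Filter.Tendsto f Filter.atTop (nhds 0))
    (hd : ∀ x, 0 ≤ x → HasDerivAt f (w x * (a - b * x)) x) (x : ℝ) (hx : 0 ≤ x) : 0 ≤ f x := by
  rcases le_total (b * x) a with h | h
  · have hm : MonotoneOn f (Set.Icc 0 x) := by
      apply monotoneOn_of_deriv_nonneg (convex_Icc 0 x)
      · intro y hy
        exact (hd y hy.1).continuousAt.continuousWithinAt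
      · intro y hy
        rw [interior_Icc] at hy
        exact (hd y hy.1.le).differentiableAt.differentiableWithinAt
      · intro y hy
        rw [interior_Icc] at hy
        rw [(hd y hy.1.le).deriv]
        apply mul_nonneg (hw y hy.1.le)
        nlinarith [mul_le_mul_of_nonneg_left hy.2.le hb.le]
    have := hm ⟨le_refl 0, hx⟩ ⟨hx, le_refl x⟩ hx
    linarith
  · have hm : AntitoneOn f (Set.Ici x) := by
      apply antitoneOn_of_deriv_nonpos (convex_Ici x)
      · intro y hy
        exact (hd y (hx.trans hy)).continuousAt.continuousWithinAt
      · intro y hy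
        rw [interior_Ici] at hy
        exact (hd y (hx.trans hy.le)).differentiableAt.differentiableWithinAt
      · intro y hy
        rw [interior_Ici] at hy
        have hy' : x < y := hy
        rw [(hd y (hx.trans hy'.le)).deriv]
        apply mul_nonpos_of_nonneg_of_nonpos (hw y (hx.trans hy'.le))
        nlinarith [mul_le_mul_of_nonneg_left hy'.le hb.le]
    refine le_of_tendsto hinf ?_
    filter_upwards [Filter.eventually_ge_atTop x] with y hy
    exact hm (le_refl x) hy hy

theorem aux_integrable : Integrable (fun u : ℝ => Real.exp (-u ^ 2 / 2)) := by
  have := integrable_exp_neg_mul_sq (b := 1 / 2) (by norm_num)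
  refine this.congr (Filter.Eventually.of_forall fun u => ?_)
  simp only
  congr 1
  ring

theorem aux_zero : ∫ u in Set.Ioi (0:ℝ), Real.exp (-u ^ 2 / 2) = 1 / Real.sqrt (2 / Real.pi) := by
  have := integral_gaussian_Ioi (1 / 2)
  have e : (fun u : ℝ => Real.exp (-u ^ 2 / 2)) = fun u => Real.exp (-(1 / 2) * u ^ 2) := by
    funext u
    congr 1
    ring
  rw [e, this, one_div (Real.sqrt _), ← Real.sqrt_inv]
  have h4 : (2:ℝ) = Real.sqrt 4 := by
    rw [show (4:ℝ) = 2 ^ 2 by norm_num, Real.sqrt_sq (by norm_num)]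
  nth_rewrite 2 [h4]
  rw [← Real.sqrt_div (by positivity)]
  congr 1
  field_simp
  norm_num

theorem aux_split (x : ℝ) : ∫ u in Set.Ioi x, Real.exp (-u ^ 2 / 2) =
    (∫ u in Set.Ioi (0:ℝ), Real.exp (-u ^ 2 / 2)) - ∫ u in (0:ℝ)..x, Real.exp (-u ^ 2 / 2) := by
  have := intervalIntegral.integral_interval_add_Ioi (μ := volume) (a := 0) (b := x)
    (f := fun u : ℝ => Real.exp (-u ^ 2 / 2)) aux_integrable.integrableOn
    aux_integrable.integrableOn
  linarith

theorem aux_deriv (x : ℝ) :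
    HasDerivAt (fun x : ℝ => ∫ u in Set.Ioi x, Real.exp (-u ^ 2 / 2)) (-Real.exp (-x ^ 2 / 2)) x := by
  rw [funext aux_split]
  have hc : Continuous (fun u : ℝ => Real.exp (-u ^ 2 / 2)) := by fun_prop
  exact (hc.integral_hasStrictDerivAt 0 x).hasDerivAt.const_sub _

theorem aux_tendsto :
    Filter.Tendsto (fun x : ℝ => ∫ u in Set.Ioi x, Real.exp (-u ^ 2 / 2)) Filter.atTop (nhds 0) := by
  rw [funext aux_split]
  have := intervalIntegral_tendsto_integral_Ioi (μ := volume) (0:ℝ)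
    (f := fun u : ℝ => Real.exp (-u ^ 2 / 2)) aux_integrable.integrableOn Filter.tendsto_id
  have h2 := this.const_sub (∫ u in Set.Ioi (0:ℝ), Real.exp (-u ^ 2 / 2))
  rw [sub_self] at h2
  exact h2

theorem aux_exp_deriv (p q x : ℝ) : HasDerivAt (fun x : ℝ => Real.exp (p * x ^ 2 / 2 + q * x))
    (Real.exp (p * x ^ 2 / 2 + q * x) * (p * x + q)) x := by
  have h : HasDerivAt (fun x : ℝ => p * x ^ 2 / 2 + q * x) (p * x + q) x := by
    have := (((hasDerivAt_pow 2 x).const_mul p).div_const 2).add ((hasDerivAt_id x).const_mul q)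
    refine this.congr_deriv ?_
    simp
    ring
  exact h.exp

theorem aux_phi_deriv (x : ℝ) : HasDerivAt (fun x : ℝ => Real.exp (-x ^ 2 / 2))
    (Real.exp (-x ^ 2 / 2) * (-x)) x := by
  have h := aux_exp_deriv (-1) 0 x
  simpa using h

theorem aux_quot_deriv (c m x : ℝ) (h : 0 < c + m * x) :
    HasDerivAt (fun x : ℝ => Real.exp (-x ^ 2 / 2) / (c + m * x) -
      ∫ u in Set.Ioi x, Real.exp (-u ^ 2 / 2))
    (Real.exp (-x ^ 2 / 2) / (c + m * x) ^ 2 * ((c + m * x) ^ 2 - x * (c + m * x) - m)) x := by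
  have hl : HasDerivAt (fun x : ℝ => c + m * x) m x := by
    simpa using ((hasDerivAt_id x).const_mul m).const_add c
  have := ((aux_phi_deriv x).div hl h.ne').sub (aux_deriv x)
  refine HasDerivAt.congr_deriv this ?_
  have hne := h.ne'
  clear this hl h
  generalize c + m * x = l at *
  generalize Real.exp (-x ^ 2 / 2) = E
  field_simp
  ring

theorem aux_quot_tendsto (c m : ℝ) (hm : 0 < m) :
    Filter.Tendsto (fun x : ℝ => Real.exp (-x ^ 2 / 2) / (c + m * x) -
      ∫ u in Set.Ioi x, Real.exp (-u ^ 2 / 2)) Filter.atTop (nhds 0) := by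
  have hl : Filter.Tendsto (fun x : ℝ => c + m * x) Filter.atTop Filter.atTop :=
    Filter.tendsto_atTop_add_const_left _ _ (Filter.tendsto_id.const_mul_atTop hm)
  have h1 : Filter.Tendsto (fun x : ℝ => Real.exp (-x ^ 2 / 2) / (c + m * x))
      Filter.atTop (nhds 0) := by
    refine squeeze_zero' ?_ ?_ (tendsto_inv_atTop_zero.comp hl)
    · filter_upwards [hl.eventually_gt_atTop 0] with x hx
      positivity
    · filter_upwards [hl.eventually_gt_atTop 0] with x hx
      have : Real.exp (-x ^ 2 / 2) ≤ 1 := by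
        apply Real.exp_le_one_iff.2
        nlinarith [sq_nonneg x]
      simp only [Function.comp]
      rw [div_eq_mul_inv]
      exact mul_le_of_le_one_left (by positivity) this
  simpa using h1.sub aux_tendsto

theorem aux_K_deriv (p q x : ℝ) :
    HasDerivAt (fun x : ℝ => Real.exp (p * x ^ 2 / 2 + q * x) *
      ∫ u in Set.Ioi x, Real.exp (-u ^ 2 / 2))
    (Real.exp (p * x ^ 2 / 2 + q * x) * ((q + p * x) * (∫ u in Set.Ioi x, Real.exp (-u ^ 2 / 2))
      - Real.exp (-x ^ 2 / 2))) x := by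
  have := (aux_exp_deriv p q x).mul (aux_deriv x)
  refine HasDerivAt.congr_deriv this ?_
  ring

theorem aux_pos (x : ℝ) : 0 < ∫ u in Set.Ioi x, Real.exp (-u ^ 2 / 2) := by
  refine (integral_pos_iff_support_of_nonneg (fun u => (Real.exp_pos _).le)
    aux_integrable.integrableOn).2 ?_
  have : Function.support (fun u : ℝ => Real.exp (-u ^ 2 / 2)) = Set.univ := by
    ext u
    simp [(Real.exp_pos _).ne']
  rw [this]
  simp

theorem log_gaussQ_between_quadratics (x : ℝ) (hx : 0 ≤ x) :
    -x ^ 2 / 2 - Real.sqrt (2 / Real.pi) * x - Real.log 2 ≤ Real.log (gaussQ x) ∧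
    Real.log (gaussQ x) ≤ -x ^ 2 / Real.pi - Real.sqrt (2 / Real.pi) * x - Real.log 2 := by
  have hz := aux_zero
  have hpi := Real.pi_pos
  have hQ : gaussQ x = Real.sqrt (2 / Real.pi) / 2 * ∫ u in Set.Ioi x, Real.exp (-u ^ 2 / 2) := by
    unfold gaussQ
    congr 1
    have h1 : Real.sqrt (2 / Real.pi) * Real.sqrt (2 * Real.pi) = 2 := by
      rw [← Real.sqrt_mul (by positivity), show 2 / Real.pi * (2 * Real.pi) = 2 ^ 2 by
        field_simp, Real.sqrt_sq (by norm_num)]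
    have h2 : 0 < Real.sqrt (2 * Real.pi) := by positivity
    rw [div_eq_div_iff h2.ne' (by norm_num)]
    linarith
  have hc2 : Real.sqrt (2 / Real.pi) ^ 2 = 2 / Real.pi := Real.sq_sqrt (by positivity)
  have hcpos : 0 < Real.sqrt (2 / Real.pi) := by positivity
  have hlt : 2 / Real.pi < 1 := by
    rw [div_lt_one hpi]; linarith [Real.pi_gt_three]
  have hgt : 1 / 2 < 2 / Real.pi := by
    rw [div_lt_div_iff₀ (by norm_num) hpi]; linarith [Real.pi_lt_four]
  have hxp : -x ^ 2 / Real.pi = -(Real.sqrt (2 / Real.pi) ^ 2 * x ^ 2 / 2) := by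
    rw [hc2]; field_simp
  rw [hxp, hQ]
  rw [← hc2] at hlt hgt
  clear hxp hQ hc2
  generalize Real.sqrt (2 / Real.pi) = c at *
  have key1 : ∀ y, 0 ≤ y → (c + c ^ 2 * y) * (∫ u in Set.Ioi y, Real.exp (-u ^ 2 / 2))
      - Real.exp (-y ^ 2 / 2) ≤ 0 := by
    intro y hy
    have := aux_nonneg _ (fun x => x * (Real.exp (-x ^ 2 / 2) / (c + c ^ 2 * x) ^ 2))
      (2 * c ^ 3 - c) (c ^ 2 - c ^ 4) (by nlinarith [pow_pos hcpos 2])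
      (fun x hx => by positivity) (by simp [hz]) (aux_quot_tendsto c (c ^ 2) (by positivity))
      (fun x hx => by
        convert aux_quot_deriv c (c ^ 2) x (by positivity) using 1
        ring) y hy
    have hl : 0 < c + c ^ 2 * y := by positivity
    rw [sub_nonneg, le_div_iff₀ hl] at this
    linarith
  have key2 : ∀ y, 0 ≤ y → 0 ≤ (c + 1 * y) * (∫ u in Set.Ioi y, Real.exp (-u ^ 2 / 2))
      - Real.exp (-y ^ 2 / 2) := by
    intro y hy
    have := aux_nonneg (fun x : ℝ => -(Real.exp (-x ^ 2 / 2) / (c + 1 * x) -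
      ∫ u in Set.Ioi x, Real.exp (-u ^ 2 / 2))) (fun x => (Real.exp (-x ^ 2 / 2) / (c + 1 * x) ^ 2))
      (1 - c ^ 2) c hcpos
      (fun x hx => by positivity) (by simp [hz])
      (by
        have h2 := (aux_quot_tendsto c 1 (by positivity)).neg
        rw [neg_zero] at h2
        exact h2)
      (fun x hx => by
        refine HasDerivAt.congr_deriv (aux_quot_deriv c 1 x (by positivity)).neg ?_
        ring) y hy
    have hl : 0 < c + 1 * y := by positivity
    have h3 := sub_nonpos.1 (neg_nonneg.1 this)
    rw [div_le_iff₀ hl] at h3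
    linarith
  have up : Real.exp (c ^ 2 * x ^ 2 / 2 + c * x) *
      (∫ u in Set.Ioi x, Real.exp (-u ^ 2 / 2)) ≤ 1 / c := by
    have hm := antitoneOn_of_deriv_nonpos (convex_Ici (0:ℝ))
      (fun y _ => (aux_K_deriv (c ^ 2) c y).continuousAt.continuousWithinAt)
      (fun y _ => (aux_K_deriv (c ^ 2) c y).differentiableAt.differentiableWithinAt)
      (fun y hy => by
        rw [interior_Ici] at hy
        rw [(aux_K_deriv (c ^ 2) c y).deriv]
        exact mul_nonpos_of_nonneg_of_nonpos (Real.exp_pos _).le (key1 y (le_of_lt hy)))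
    have := hm (Set.mem_Ici.2 le_rfl) (Set.mem_Ici.2 hx) hx
    simpa [hz] using this
  have lo : 1 / c ≤ Real.exp (1 * x ^ 2 / 2 + c * x) *
      (∫ u in Set.Ioi x, Real.exp (-u ^ 2 / 2)) := by
    have hm := monotoneOn_of_deriv_nonneg (convex_Ici (0:ℝ))
      (fun y _ => (aux_K_deriv 1 c y).continuousAt.continuousWithinAt)
      (fun y _ => (aux_K_deriv 1 c y).differentiableAt.differentiableWithinAt)
      (fun y hy => by
        rw [interior_Ici] at hy
        rw [(aux_K_deriv 1 c y).deriv]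
        exact mul_nonneg (Real.exp_pos _).le (key2 y (le_of_lt hy)))
    have := hm (Set.mem_Ici.2 le_rfl) (Set.mem_Ici.2 hx) hx
    simpa [hz] using this
  have hI := aux_pos x
  generalize (∫ u in Set.Ioi x, Real.exp (-u ^ 2 / 2)) = J at *
  have e : Real.log (c / 2 * J) = Real.log c - Real.log 2 + Real.log J := by
    rw [Real.log_mul (by positivity) hI.ne', Real.log_div hcpos.ne' (by norm_num)]
  have u' := Real.log_le_log (by positivity) up
  have l' := Real.log_le_log (by positivity) lo
  rw [Real.log_mul (Real.exp_pos _).ne' hI.ne', Real.log_exp, one_div, Real.log_inv] at u' l'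
  rw [e]
  constructor <;> linarith
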